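/- (Proposition 4.1, second part.) For the PBM model, i.i.d. queries q ~ Pr(Q), and under the condition that the query distribution is independent of the choice of ranker, the expectation of the non-click count ¬ĉ_{k'}^{k,k'} satisfies E[¬ĉ_{k'}^{k,k'}] = N_{k,k'} − p_{k'} · r_{k,k'}, where r_{k,k'} = E_q[ Σ_{d ∈ Ω(q)} 1[(q,d) ∈ S_{k,k'}] · rel(q,d) ] and N_{k,k'} = E_q[ Σ_{d ∈ Ω(q)} 1[(q,d) ∈ S_{k,k'}] ]. Concretely: Σ_{i=1}^m Σ_{j=1}^{n_i} Σ_{q ∈ Q} Pr(q) Σ_{d ∈ Ω(q)} 1[(q,d) ∈ S_{k,k'}] · 1[rank(d | f_i(q)) = k'] · (1 − p_{k'} · rel(q,d)) / w(q,d,k') = N_{k,k'} − p_{k'} · r_{k,k'}, provided that for every (q,d) ∈ S_{k,k'} with Pr(q) > 0 some ranker with n_i > 0 places d at rank k'. -/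

import Mathlib

/-- Real-valued indicator of a proposition. -/
noncomputable def indR (P : Prop) : ℝ := @ite ℝ P (Classical.propDecidable P) 1 0

/-- Membership of the pair `(q, d)` in the interventional set `S_{k,k'}`:
`d` is a candidate for `q`, some ranker puts `d` at rank `k` for `q`,
and some (other) ranker puts `d` at rank `k'` for `q`. -/
def Smem {Q D : Type*} (m : ℕ) (rnk : Fin m → Q → D → ℕ) (Ω : Q → Finset D)
    (q : Q) (d : D) (k k' : ℕ) : Prop :=
  d ∈ Ω q ∧ (∃ i : Fin m, rnk i q d = k) ∧ (∃ i' : Fin m, rnk i' q d = k')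

/-- The weight `w(q,d,k) = ∑_i n_i · 1[rank(d | f_i(q)) = k]`. -/
noncomputable def wgt {Q D : Type*} (m : ℕ) (n : Fin m → ℕ) (rnk : Fin m → Q → D → ℕ)
    (q : Q) (d : D) (k : ℕ) : ℝ :=
  ∑ i : Fin m, (n i : ℝ) * indR (rnk i q d = k)

theorem indR_of_true {P : Prop} (h : P) : indR P = 1 := if_pos h

theorem indR_of_false {P : Prop} (h : ¬P) : indR P = 0 := if_neg h

theorem indR_nonneg (P : Prop) : 0 ≤ indR P := by
  by_cases h : P
  · rw [indR_of_true h]; exact zero_le_one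
  · rw [indR_of_false h]

theorem wgt_pos {Q D : Type*} {m : ℕ} {n : Fin m → ℕ} {rnk : Fin m → Q → D → ℕ}
    {q : Q} {d : D} {k : ℕ} (h : ∃ i : Fin m, 0 < n i ∧ rnk i q d = k) :
    0 < wgt m n rnk q d k := by
  obtain ⟨i, hn, hi⟩ := h
  refine Finset.sum_pos' (fun j _ => mul_nonneg (Nat.cast_nonneg _) (indR_nonneg _))
    ⟨i, Finset.mem_univ i, ?_⟩
  rw [indR_of_true hi, mul_one]
  exact_mod_cast hn

/-- Summing inverse-weighted indicators over all rankers reproduces the weight itself. -/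
theorem sum_mul_indR_mul_div_wgt {Q D : Type*} (m : ℕ) (n : Fin m → ℕ)
    (rnk : Fin m → Q → D → ℕ) (q : Q) (d : D) (k : ℕ) (a b : ℝ) :
    ∑ i : Fin m, (n i : ℝ) * (a * indR (rnk i q d = k) * b / wgt m n rnk q d k)
      = a * b * (wgt m n rnk q d k / wgt m n rnk q d k) := by
  have h : wgt m n rnk q d k / wgt m n rnk q d k
      = ∑ i : Fin m, (n i : ℝ) * indR (rnk i q d = k) / wgt m n rnk q d k := by
    rw [← Finset.sum_div]; rfl
  rw [h, Finset.mul_sum]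
  exact Finset.sum_congr rfl fun i _ => by ring

/-- **Proposition 4.1, second part.** For the PBM model, i.i.d. queries
`q ~ Pr(Q)`, and under the condition that the query distribution is independent of the
choice of ranker, the expectation of the non-click count `¬ĉ_{k'}^{k,k'}` satisfies
`E[¬ĉ_{k'}^{k,k'}] = N_{k,k'} − p k' · r_{k,k'}`, where
`r_{k,k'} = E_q[∑_{d ∈ Ω(q)} 1[(q,d) ∈ S_{k,k'}] · rel(q,d)]` and
`N_{k,k'} = E_q[∑_{d ∈ Ω(q)} 1[(q,d) ∈ S_{k,k'}]]`, provided that for every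
`(q,d) ∈ S_{k,k'}` with `Pr q > 0` some ranker with `n i > 0` places `d` at rank `k'`. -/
theorem prop_4_1_second_part {Q D : Type*} [Fintype Q]
    (Pr : Q → ℝ) (Ω : Q → Finset D) (rel : Q → D → ℝ)
    (m : ℕ) (n : Fin m → ℕ) (rnk : Fin m → Q → D → ℕ)
    (p : ℕ → ℝ) (k k' : ℕ)
    (hkk' : k ≠ k')
    (hrel : ∀ q d, rel q d = 0 ∨ rel q d = 1)
    (hp : ∀ j, 0 ≤ p j ∧ p j ≤ 1)
    (hPr : ∀ q, 0 ≤ Pr q) (hPrsum : ∑ q : Q, Pr q = 1)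
    (hsupp : ∀ q d, Smem m rnk Ω q d k k' → 0 < Pr q →
      ∃ i : Fin m, 0 < n i ∧ rnk i q d = k') :
    ∑ i : Fin m, ∑ _j ∈ Finset.range (n i), ∑ q : Q, Pr q *
        ∑ d ∈ Ω q, indR (Smem m rnk Ω q d k k') * indR (rnk i q d = k') *
          (1 - p k' * rel q d) / wgt m n rnk q d k'
      = (∑ q : Q, Pr q * ∑ d ∈ Ω q, indR (Smem m rnk Ω q d k k'))
        - p k' * ∑ q : Q, Pr q *
            ∑ d ∈ Ω q, indR (Smem m rnk Ω q d k k') * rel q d := by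
  simp only [Finset.sum_const, Finset.card_range, nsmul_eq_mul, Finset.mul_sum]
  rw [Finset.sum_comm, ← Finset.sum_sub_distrib]
  refine Finset.sum_congr rfl fun q _ => ?_
  rw [Finset.sum_comm, ← Finset.sum_sub_distrib]
  refine Finset.sum_congr rfl fun d _ => ?_
  simp only [mul_left_comm _ (Pr q)]
  rw [← Finset.mul_sum, sum_mul_indR_mul_div_wgt]
  by_cases hS : Smem m rnk Ω q d k k'
  · rcases (hPr q).eq_or_lt with h0 | h0
    · simp [← h0]
    · rw [div_self (wgt_pos (hsupp q d hS h0)).ne']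
      ring
  · simp [indR_of_false hS]
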